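/- arXiv:1301.6667 — 2 statements merged into one kernel-verified Lean document; each statement's English description precedes it below -/
import Mathlib

section
/- Let S be an antipodal point set of 2n points on the unit circle (n ≥ 3). Every thin antipodal polygon on S has strictly smaller area than every non-thin antipodal polygon on S. -/
open MeasureTheory

/-- The point on the unit circle at angle `θ`. -/
noncomputable def pt (θ : ℝ) : ℝ × ℝ := (Real.cos θ, Real.sin θ)

/-- Standard dot product in the plane. -/
noncomputable def dotp (v w : ℝ × ℝ) : ℝ := v.1 * w.1 + v.2 * w.2

/-- Given angles `θ : Fin n → ℝ` (determining the antipodal point set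
`{pt (θ i)} ∪ {-pt (θ i)}`) and a selection `ε`, the `i`-th vertex of the
corresponding antipodal polygon: `pt (θ i)` if `ε i` and `-pt (θ i)` otherwise. -/
noncomputable def vtx {n : ℕ} (θ : Fin n → ℝ) (ε : Fin n → Bool) (i : Fin n) : ℝ × ℝ :=
  if ε i then pt (θ i) else -pt (θ i)

/-- The antipodal polygon determined by the selection `ε`. -/
noncomputable def apoly {n : ℕ} (θ : Fin n → ℝ) (ε : Fin n → Bool) : Set (ℝ × ℝ) :=
  convexHull ℝ (Set.range (vtx θ ε))

/-- The antipodal polygon is thin: all vertices lie in a closed half-plane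
bounded by a line through the origin. -/
def Thin {n : ℕ} (θ : Fin n → ℝ) (ε : Fin n → Bool) : Prop :=
  ∃ v : ℝ × ℝ, v ≠ 0 ∧ ∀ i, 0 ≤ dotp v (vtx θ ε i)

/-- The antipodal polygon is thick: every open half-plane bounded by a line
through the origin contains at least `⌈(n-2)/2⌉ = (n-1)/2` of its vertices. -/
def Thick {n : ℕ} (θ : Fin n → ℝ) (ε : Fin n → Bool) : Prop :=
  ∀ v : ℝ × ℝ, v ≠ 0 →
    (n - 1) / 2 ≤ Set.ncard {i : Fin n | 0 < dotp v (vtx θ ε i)}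

/-- The `j`-th point (indices mod `2*n`) of the antipodal point set in circular
order `pt (θ 0), …, pt (θ (n-1)), -pt (θ 0), …, -pt (θ (n-1))`. -/
noncomputable def spt {n : ℕ} (θ : Fin n → ℝ) (j : ℕ) : ℝ × ℝ :=
  if h : j % (2 * n) < n then pt (θ ⟨j % (2 * n), h⟩)
  else if h2 : j % (2 * n) - n < n then -pt (θ ⟨j % (2 * n) - n, h2⟩) else 0

/-- Whether the `j`-th point (indices mod `2*n`) of the antipodal point set, in the
circular order `pt (θ 0), …, pt (θ (n-1)), -pt (θ 0), …, -pt (θ (n-1))`,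
is a vertex of the antipodal polygon selected by `ε`. -/
def chosen {n : ℕ} (ε : Fin n → Bool) (j : ℕ) : Bool :=
  if h : j % (2 * n) < n then ε ⟨j % (2 * n), h⟩
  else if h2 : j % (2 * n) - n < n then !(ε ⟨j % (2 * n) - n, h2⟩) else false

open scoped Pointwise

/-- Twice the signed area of the triangle `a b c`. -/
def orient (a b c : ℝ × ℝ) : ℝ :=
  (b.1 - a.1) * (c.2 - a.2) - (b.2 - a.2) * (c.1 - a.1)

theorem orient_rotate (a b c : ℝ × ℝ) : orient a b c = orient b c a := by
  unfold orient; ring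

theorem orient_swap (a b c : ℝ × ℝ) : orient a b c = -orient b a c := by
  unfold orient; ring

theorem orient_combo (a b x y : ℝ × ℝ) {s t : ℝ} (h : s + t = 1) :
    orient a b (s • x + t • y) = s * orient a b x + t * orient a b y := by
  obtain rfl : s = 1 - t := by linarith
  simp only [orient, Prod.fst_add, Prod.snd_add, Prod.smul_fst, Prod.smul_snd, smul_eq_mul]
  ring

theorem orient_nonneg_of_mem_convexHull {a b x : ℝ × ℝ} {B : Set (ℝ × ℝ)}
    (h : ∀ y ∈ B, 0 ≤ orient a b y) (hx : x ∈ convexHull ℝ B) : 0 ≤ orient a b x := by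
  have hc : Convex ℝ {y | 0 ≤ orient a b y} := by
    intro y hy z hz s t hs ht hst
    simp only [Set.mem_ofPred_eq] at *
    rw [orient_combo a b y z hst]
    positivity
  exact convexHull_min h hc hx

theorem mem_triangle_of_orient_nonneg {a b c x : ℝ × ℝ} (h : 0 < orient a b c)
    (h₁ : 0 ≤ orient a b x) (h₂ : 0 ≤ orient b c x) (h₃ : 0 ≤ orient c a x) :
    x ∈ convexHull ℝ {a, b, c} := by
  rw [convexHull_insert (by simp), convexHull_pair]
  simp only [convexJoin_singleton_left, Set.mem_iUnion]
  have key : orient a b x + orient b c x + orient c a x = orient a b c := by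
    unfold orient; ring
  by_cases h0 : orient a b x + orient c a x = 0
  · have e1 : orient a b x = 0 := by linarith
    have e2 : orient c a x = 0 := by linarith
    have hx : x = a := by
      have f1 : orient a b c * (x.1 - a.1) = 0 := by
        have : orient a b c * (x.1 - a.1) =
          (c.1 - a.1) * orient a b x + (b.1 - a.1) * orient c a x := by unfold orient; ring
        rw [this, e1, e2]; ring
      have f2 : orient a b c * (x.2 - a.2) = 0 := by
        have : orient a b c * (x.2 - a.2) =
          (c.2 - a.2) * orient a b x + (b.2 - a.2) * orient c a x := by unfold orient; ring
        rw [this, e1, e2]; ring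
      have g1 := (mul_eq_zero.1 f1).resolve_left h.ne'
      have g2 := (mul_eq_zero.1 f2).resolve_left h.ne'
      ext <;> linarith
    exact ⟨b, left_mem_segment ℝ b c, hx ▸ left_mem_segment ℝ a b⟩
  · set m := orient a b x + orient c a x with hm
    have hmpos : 0 < m := lt_of_le_of_ne (by positivity) (Ne.symm h0)
    refine ⟨(orient c a x / m) • b + (orient a b x / m) • c,
      ⟨_, _, by positivity, by positivity, ?_, rfl⟩,
      ⟨orient b c x / orient a b c, m / orient a b c, by positivity, by positivity, ?_, ?_⟩⟩
    · field_simp; linarith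
    · field_simp; linarith
    · ext
      · simp only [Prod.fst_add, Prod.smul_fst, smul_eq_mul]
        field_simp
        unfold orient; ring
      · simp only [Prod.snd_add, Prod.smul_snd, smul_eq_mul]
        field_simp
        unfold orient; ring

theorem convexHull_insert_subset_union_triangle {q p p' : ℝ × ℝ} {B : Set (ℝ × ℝ)}
    (hp : p ∈ B) (hp' : p' ∈ B) (hD : 0 < orient q p p')
    (h₁ : ∀ y ∈ B, 0 ≤ orient q p y) (h₂ : ∀ y ∈ B, 0 ≤ orient p' q y)
    (h₃ : ∀ y ∈ B, 0 ≤ orient p' p y) :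
    convexHull ℝ (insert q B) ⊆ convexHull ℝ B ∪ convexHull ℝ {q, p, p'} := by
  intro x hx
  rw [convexHull_insert ⟨p, hp⟩] at hx
  simp only [convexJoin_singleton_left, Set.mem_iUnion] at hx
  obtain ⟨y, hy, s, t, hs, ht, hst, rfl⟩ := hx
  have y1 := orient_nonneg_of_mem_convexHull h₁ hy
  have y2 := orient_nonneg_of_mem_convexHull h₂ hy
  have y3 := orient_nonneg_of_mem_convexHull h₃ hy
  have e1 : orient q p q = 0 := by unfold orient; ring
  have e2 : orient p' q q = 0 := by unfold orient; ring
  have e3 : orient p' p q = -orient q p p' := by unfold orient; ring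
  by_cases hl : 0 ≤ orient p p' (s • q + t • y)
  · right
    refine mem_triangle_of_orient_nonneg hD ?_ hl ?_
    · rw [orient_combo _ _ _ _ hst, e1]; positivity
    · rw [orient_combo _ _ _ _ hst, e2]; positivity
  · left
    push Not at hl
    rw [orient_swap] at hl
    have hl' := hl
    rw [orient_combo _ _ _ _ hst, e3] at hl'
    have hty : 0 < t * orient p' p y := by nlinarith [mul_nonneg hs hD.le]
    have hy0 : 0 < orient p' p y := pos_of_mul_pos_right hty ht
    have hmem : s • q + t • y ∈ convexHull ℝ {p', p, y} := by
      refine mem_triangle_of_orient_nonneg hy0 (by linarith) ?_ ?_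
      · rw [orient_combo _ _ _ _ hst]
        have a1 : orient p y y = 0 := by unfold orient; ring
        have a2 : orient p y q = orient q p y := by unfold orient; ring
        rw [a1, a2]; positivity
      · rw [orient_combo _ _ _ _ hst]
        have a1 : orient y p' y = 0 := by unfold orient; ring
        have a2 : orient y p' q = orient p' q y := by unfold orient; ring
        rw [a1, a2]; positivity
    refine convexHull_min ?_ (convex_convexHull ℝ B) hmem
    rintro z (rfl | rfl | rfl)
    · exact subset_convexHull ℝ B hp'
    · exact subset_convexHull ℝ B hp
    · exact hy

/-- The reference triangle with vertices `(0, 0)`, `(1, 0)` and `(0, 1)`. -/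
def stdTriangle : Set (ℝ × ℝ) := convexHull ℝ {(0, 0), (1, 0), (0, 1)}

theorem volume_triangle (a b c : ℝ × ℝ) :
    volume (convexHull ℝ {a, b, c}) = ENNReal.ofReal |orient a b c| * volume stdTriangle := by
  let L : ℝ × ℝ →ₗ[ℝ] ℝ × ℝ :=
    Matrix.toLin (Module.Basis.finTwoProd ℝ) (Module.Basis.finTwoProd ℝ)
      !![b.1 - a.1, c.1 - a.1; b.2 - a.2, c.2 - a.2]
  have hdet : LinearMap.det L = orient a b c := by
    rw [LinearMap.det_toLin, Matrix.det_fin_two_of]; unfold orient; ring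
  have hL (x : ℝ × ℝ) : L x = ((b.1 - a.1) * x.1 + (c.1 - a.1) * x.2,
      (b.2 - a.2) * x.1 + (c.2 - a.2) * x.2) := Matrix.toLin_finTwoProd_apply _ _ _ _ _
  have himg : convexHull ℝ {a, b, c} = (fun x => a + x) '' (L '' stdTriangle) := by
    have h := AffineMap.image_convexHull
      (AffineMap.const ℝ (ℝ × ℝ) a + L.toAffineMap) {((0 : ℝ), (0 : ℝ)), (1, 0), (0, 1)}
    rw [stdTriangle, Set.image_image]
    have hf : (fun x => a + L x) = ⇑(AffineMap.const ℝ (ℝ × ℝ) a + L.toAffineMap) := by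
      ext x <;> simp
    rw [hf, h, ← hf]
    simp only [Set.image_insert_eq, Set.image_singleton, hL]
    congr 2
    · ext <;> simp
    · congr 1
      · ext <;> simp
      · congr 1
        ext <;> simp
  rw [himg, Set.image_add_left, measure_preimage_add, Measure.addHaar_image_linearMap, hdet]

theorem volume_orient_eq_zero {a b : ℝ × ℝ} (h : a ≠ b) :
    volume {x | orient a b x = 0} = 0 := by
  let L : ℝ × ℝ →ₗ[ℝ] ℝ :=
    (b.1 - a.1) • LinearMap.snd ℝ ℝ ℝ - (b.2 - a.2) • LinearMap.fst ℝ ℝ ℝ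
  have hs : {x | orient a b x = 0} = (AffineSubspace.mk' a L.ker : Set (ℝ × ℝ)) := by
    ext x
    simp [L, orient, AffineSubspace.mem_mk']
  rw [hs]
  refine Measure.addHaar_affineSubspace _ _ fun htop => h ?_
  have m1 : ((a.1 - (b.2 - a.2), a.2 + (b.1 - a.1)) : ℝ × ℝ) ∈ AffineSubspace.mk' a L.ker := by
    rw [htop]; trivial
  simp [L, AffineSubspace.mem_mk'] at m1
  have e1 : b.1 - a.1 = 0 := by nlinarith [sq_nonneg (b.2 - a.2), sq_nonneg (b.1 - a.1)]
  have e2 : b.2 - a.2 = 0 := by nlinarith [sq_nonneg (b.2 - a.2), sq_nonneg (b.1 - a.1)]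
  ext <;> linarith

theorem volume_add_triangle_le {q p p' : ℝ × ℝ} {B : Set (ℝ × ℝ)}
    (hp : p ∈ B) (hp' : p' ∈ B) (hD : 0 < orient q p p')
    (h₃ : ∀ y ∈ B, 0 ≤ orient p' p y) :
    volume (convexHull ℝ B) + ENNReal.ofReal (orient q p p') * volume stdTriangle ≤
      volume (convexHull ℝ (insert q B)) := by
  have hne : p' ≠ p := by
    rintro rfl
    simp [orient, mul_comm] at hD
  have htri : convexHull ℝ {q, p, p'} ⊆ {x | orient p' p x ≤ 0} := by
    intro x hx
    have : 0 ≤ orient p p' x := by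
      refine orient_nonneg_of_mem_convexHull ?_ hx
      rintro z (rfl | rfl | rfl)
      · rw [← orient_rotate]; exact hD.le
      · unfold orient; apply le_of_eq; ring
      · unfold orient; apply le_of_eq; ring
    rw [orient_swap] at this
    simpa using this
  have hdisj : AEDisjoint volume (convexHull ℝ B) (convexHull ℝ {q, p, p'}) := by
    refine measure_mono_null ?_ (volume_orient_eq_zero hne)
    rintro x ⟨hx, hx'⟩
    exact le_antisymm (htri hx') (orient_nonneg_of_mem_convexHull h₃ hx)
  have hmeas : NullMeasurableSet (convexHull ℝ {q, p, p'}) (volume : Measure (ℝ × ℝ)) :=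
    (((Set.toFinite _).isCompact_convexHull ℝ).isClosed.measurableSet).nullMeasurableSet
  rw [← abs_of_pos hD, ← volume_triangle, ← measure_union₀ hmeas hdisj]
  refine measure_mono (Set.union_subset (convexHull_mono (Set.subset_insert _ _)) ?_)
  refine convexHull_mono ?_
  rintro z (rfl | rfl | rfl)
  · exact Set.mem_insert _ _
  · exact Set.mem_insert_of_mem _ hp
  · exact Set.mem_insert_of_mem _ hp'

theorem orient_pt (u v w : ℝ) : orient (pt u) (pt v) (pt w) =
    4 * Real.sin ((v - u) / 2) * Real.sin ((w - v) / 2) * Real.sin ((w - u) / 2) := by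
  have h₁ : orient (pt u) (pt v) (pt w) =
      Real.sin (v - u) + Real.sin (w - v) - Real.sin (w - u) := by
    simp only [orient, pt, Real.sin_sub]; ring
  obtain ⟨x, hx⟩ : ∃ x, x = (v - u) / 2 := ⟨_, rfl⟩
  obtain ⟨y, hy⟩ : ∃ y, y = (w - v) / 2 := ⟨_, rfl⟩
  have e₁ : v - u = 2 * x := by linarith
  have e₂ : w - v = 2 * y := by linarith
  have e₃ : w - u = 2 * (x + y) := by linarith
  rw [h₁, e₁, e₂, e₃, mul_div_cancel_left₀ _ two_ne_zero, mul_div_cancel_left₀ _ two_ne_zero,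
    mul_div_cancel_left₀ _ two_ne_zero]
  simp only [Real.sin_two_mul, Real.sin_add, Real.cos_add]
  linear_combination
    (-2 * Real.sin x * Real.cos x) * Real.sin_sq_add_cos_sq y +
    (-2 * Real.sin y * Real.cos y) * Real.sin_sq_add_cos_sq x

theorem orient_pt_nonneg {u v w : ℝ} (h₁ : u ≤ v) (h₂ : v ≤ w) (h₃ : w ≤ u + 2 * Real.pi) :
    0 ≤ orient (pt u) (pt v) (pt w) := by
  rw [orient_pt]
  have a₁ := Real.sin_nonneg_of_nonneg_of_le_pi (x := (v - u) / 2) (by linarith) (by linarith)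
  have a₂ := Real.sin_nonneg_of_nonneg_of_le_pi (x := (w - v) / 2) (by linarith) (by linarith)
  have a₃ := Real.sin_nonneg_of_nonneg_of_le_pi (x := (w - u) / 2) (by linarith) (by linarith)
  positivity

theorem orient_pt_pos {u v w : ℝ} (h₁ : u < v) (h₂ : v < w) (h₃ : w < u + 2 * Real.pi) :
    0 < orient (pt u) (pt v) (pt w) := by
  rw [orient_pt]
  have a₁ := Real.sin_pos_of_pos_of_lt_pi (x := (v - u) / 2) (by linarith) (by linarith)
  have a₂ := Real.sin_pos_of_pos_of_lt_pi (x := (w - v) / 2) (by linarith) (by linarith)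
  have a₃ := Real.sin_pos_of_pos_of_lt_pi (x := (w - u) / 2) (by linarith) (by linarith)
  positivity

theorem orient_pt_mono {t u v u' v' : ℝ} (hu : t ≤ u) (huu : u ≤ u') (hvv : v' ≤ v)
    (hv : v ≤ t + 2 * Real.pi) (h : Real.pi ≤ v' - u') :
    orient (pt t) (pt u) (pt v) ≤ orient (pt t) (pt u') (pt v') := by
  obtain ⟨x, hx⟩ : ∃ x, x = (u - t) / 2 := ⟨_, rfl⟩
  obtain ⟨y, hy⟩ : ∃ y, y = Real.pi - (v - t) / 2 := ⟨_, rfl⟩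
  obtain ⟨x', hx'⟩ : ∃ x, x = (u' - t) / 2 := ⟨_, rfl⟩
  obtain ⟨y', hy'⟩ : ∃ y, y = Real.pi - (v' - t) / 2 := ⟨_, rfl⟩
  rw [orient_pt, orient_pt, ← hx, ← hx', show (v - t) / 2 = Real.pi - y by linarith,
    show (v' - t) / 2 = Real.pi - y' by linarith, show (v - u) / 2 = Real.pi - (x + y) by linarith,
    show (v' - u') / 2 = Real.pi - (x' + y') by linarith]
  simp only [Real.sin_pi_sub]
  have hpi := Real.pi_pos
  have m {a b : ℝ} (ha : 0 ≤ a) (hab : a ≤ b) (hb : b ≤ Real.pi / 2) :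
      Real.sin a ≤ Real.sin b := Real.sin_le_sin_of_le_of_le_pi_div_two (by linarith) hb hab
  have n {a : ℝ} (ha : 0 ≤ a) (hb : a ≤ Real.pi / 2) : 0 ≤ Real.sin a :=
    Real.sin_nonneg_of_nonneg_of_le_pi ha (by linarith)
  have n₁ := n (a := x) (by linarith) (by linarith)
  have n₂ := n (a := y) (by linarith) (by linarith)
  have n₃ := n (a := x + y) (by linarith) (by linarith)
  have n₄ := n (a := x') (by linarith) (by linarith)
  have n₅ := n (a := y') (by linarith) (by linarith)
  have m₁ := m (a := x) (b := x') (by linarith) (by linarith) (by linarith)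
  have m₂ := m (a := y) (b := y') (by linarith) (by linarith) (by linarith)
  have m₃ := m (a := x + y) (b := x' + y') (by linarith) (by linarith) (by linarith)
  have n₆ := n₃.trans m₃
  gcongr

theorem exists_pt_eq (t : ℝ) {y : ℝ × ℝ} (hy : y.1 ^ 2 + y.2 ^ 2 = 1) :
    ∃ u, t ≤ u ∧ u < t + 2 * Real.pi ∧ pt u = y := by
  obtain ⟨x, hx⟩ : ∃ x, pt x = y := by
    have hn : ‖(⟨y.1, y.2⟩ : ℂ)‖ = 1 := by
      rw [Complex.norm_def, Complex.normSq_mk, Real.sqrt_eq_one]; linarith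
    have h0 : (⟨y.1, y.2⟩ : ℂ) ≠ 0 := by
      intro h; rw [h] at hn; simp at hn
    refine ⟨Complex.arg ⟨y.1, y.2⟩, ?_⟩
    ext
    · simp [pt, Complex.cos_arg h0, hn]
    · simp [pt, Complex.sin_arg, hn]
  have h := toIcoMod_mem_Ico Real.two_pi_pos t x
  refine ⟨toIcoMod Real.two_pi_pos t x, h.1, h.2, ?_⟩
  rw [← hx, ← self_sub_toIcoDiv_zsmul, zsmul_eq_mul, pt, Real.cos_sub_int_mul_two_pi,
    Real.sin_sub_int_mul_two_pi, pt]

theorem pt_sq_add_sq (t : ℝ) : (pt t).1 ^ 2 + (pt t).2 ^ 2 = 1 := by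
  simp [pt]

theorem orient_of_extremal_angles {B : Set (ℝ × ℝ)} {f : ℝ × ℝ → ℝ} {t : ℝ} {p p' : ℝ × ℝ}
    (hf : ∀ y ∈ B, t < f y ∧ f y < t + 2 * Real.pi ∧ pt (f y) = y)
    (hp : p ∈ B) (hp' : p' ∈ B) (hmin : ∀ y ∈ B, f p ≤ f y) (hmax : ∀ y ∈ B, f y ≤ f p')
    (h0 : (0 : ℝ × ℝ) ∈ convexHull ℝ B) :
    0 < orient (pt t) p p' ∧ (∀ y ∈ B, 0 ≤ orient (pt t) p y) ∧
      (∀ y ∈ B, 0 ≤ orient p' (pt t) y) ∧ (∀ y ∈ B, 0 ≤ orient p' p y) ∧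
      Real.pi ≤ f p' - f p := by
  obtain ⟨p1, p2, p3⟩ := hf p hp
  obtain ⟨p1', p2', p3'⟩ := hf p' hp'
  have hlt : f p < f p' := by
    by_contra! hle
    have hB : B ⊆ {p} := by
      intro y hy
      have := hmin y hy
      have := hmax y hy
      rw [Set.mem_singleton_iff, ← p3, ← (hf y hy).2.2]
      congr 1
      linarith
    have := convexHull_mono hB h0
    rw [convexHull_singleton, Set.mem_singleton_iff] at this
    have h1 := pt_sq_add_sq (f p)
    rw [p3, ← this] at h1
    simp at h1
  have h₃ : ∀ y ∈ B, 0 ≤ orient p' p y := by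
    intro y hy
    have := (hf y hy).2.2
    rw [orient_rotate, ← p3, ← p3', ← this]
    exact orient_pt_nonneg (hmin y hy) (hmax y hy) (by linarith)
  refine ⟨?_, ?_, ?_, h₃, ?_⟩
  · rw [← p3, ← p3']
    exact orient_pt_pos p1 hlt p2'
  · intro y hy
    obtain ⟨y1, y2, y3⟩ := hf y hy
    rw [← p3, ← y3]
    exact orient_pt_nonneg p1.le (hmin y hy) y2.le
  · intro y hy
    obtain ⟨y1, y2, y3⟩ := hf y hy
    rw [orient_rotate, ← p3', ← y3]
    exact orient_pt_nonneg y1.le (hmax y hy) p2'.le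
  · by_contra! hpi
    have h := orient_nonneg_of_mem_convexHull h₃ h0
    have hs := Real.sin_pos_of_pos_of_lt_pi (sub_pos.2 hlt) hpi
    have e : orient p' p 0 = -Real.sin (f p' - f p) := by
      nth_rewrite 1 [← p3']
      nth_rewrite 1 [← p3]
      simp only [orient, pt, Real.sin_sub, Prod.fst_zero, Prod.snd_zero]
      ring
    linarith

theorem volume_symmetrization_insert_le {A : Set (ℝ × ℝ)} (hA : A.Finite)
    (hu : ∀ y ∈ A, y.1 ^ 2 + y.2 ^ 2 = 1) (h0 : (0 : ℝ × ℝ) ∈ convexHull ℝ A)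
    {q : ℝ × ℝ} (hq : q.1 ^ 2 + q.2 ^ 2 = 1)
    (ih : volume (convexHull ℝ (A ∪ -A)) ≤ 2 * volume (convexHull ℝ A)) :
    volume (convexHull ℝ (insert q A ∪ -insert q A)) ≤
      2 * volume (convexHull ℝ (insert q A)) := by
  have hset : insert q A ∪ -insert q A = insert (-q) (insert q (A ∪ -A)) := by
    ext y
    simp only [Set.mem_union, Set.mem_insert_iff, Set.mem_neg, neg_eq_iff_eq_neg]
    tauto
  by_cases hqB : q ∈ A ∪ -A
  · have hqB' : -q ∈ A ∪ -A := by
      simpa only [Set.mem_union, Set.mem_neg, neg_neg, or_comm] using hqB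
    rw [hset, Set.insert_eq_of_mem hqB, Set.insert_eq_of_mem hqB']
    refine ih.trans ?_
    gcongr
    exact Set.subset_insert q A
  obtain ⟨t, -, -, rfl⟩ := exists_pt_eq 0 hq
  have huB : ∀ y ∈ A ∪ -A, y.1 ^ 2 + y.2 ^ 2 = 1 := by
    rintro y (hy | hy)
    · exact hu y hy
    · simpa using hu _ hy
  have hex (y : ℝ × ℝ) : ∃ u, y ∈ A ∪ -A → t < u ∧ u < t + 2 * Real.pi ∧ pt u = y := by
    by_cases hy : y ∈ A ∪ -A
    · obtain ⟨u, h1, h2, h3⟩ := exists_pt_eq t (huB y hy)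
      refine ⟨u, fun _ => ⟨lt_of_le_of_ne h1 ?_, h2, h3⟩⟩
      rintro rfl
      exact hqB (h3 ▸ hy)
    · exact ⟨0, fun h => absurd h hy⟩
  choose f hf using hex
  have hne : A.Nonempty := convexHull_nonempty_iff.1 ⟨0, h0⟩
  have hAB : A ⊆ A ∪ -A := Set.subset_union_left
  have hB : (A ∪ -A).Finite := hA.union hA.neg
  obtain ⟨p, hp, hmin⟩ := Set.exists_min_image A f hA hne
  obtain ⟨p', hp', hmax⟩ := Set.exists_max_image A f hA hne
  obtain ⟨s, hs, hsmin⟩ := Set.exists_min_image _ f hB (hne.mono hAB)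
  obtain ⟨s', hs', hsmax⟩ := Set.exists_max_image _ f hB (hne.mono hAB)
  have h0B : (0 : ℝ × ℝ) ∈ convexHull ℝ (A ∪ -A) := convexHull_mono hAB h0
  obtain ⟨d, d₁, d₂, d₃, dpi⟩ :=
    orient_of_extremal_angles (fun y hy => hf y (hAB hy)) hp hp' hmin hmax h0
  obtain ⟨e, e₁, e₂, e₃, -⟩ := orient_of_extremal_angles hf hs hs' hsmin hsmax h0B
  have hmono : orient (pt t) s s' ≤ orient (pt t) p p' := by
    obtain ⟨a1, -, a3⟩ := hf s hs
    obtain ⟨-, b2, b3⟩ := hf s' hs'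
    have c3 := (hf p (hAB hp)).2.2
    have d3 := (hf p' (hAB hp')).2.2
    rw [← a3, ← b3, ← c3, ← d3]
    exact orient_pt_mono a1.le (hsmin p (hAB hp)) (hsmax p' (hAB hp')) b2.le dpi
  have hlow := volume_add_triangle_le hp hp' d d₃
  have hup := convexHull_insert_subset_union_triangle hs hs' e e₁ e₂ e₃
  have hneg : ∀ y ∈ A ∪ -A, -y ∈ A ∪ -A := fun y hy => by
    simpa only [Set.mem_union, Set.mem_neg, neg_neg, or_comm] using hy
  have on (a b c : ℝ × ℝ) : orient (-a) (-b) c = orient a b (-c) := by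
    simp only [orient, Prod.fst_neg, Prod.snd_neg]; ring
  have om (a b c d : ℝ × ℝ) :
      orient a b (-c) = orient a b d + orient a b (-d) - orient a b c := by
    simp only [orient, Prod.fst_neg, Prod.snd_neg]; ring
  have z₁ : orient (pt t) s (pt t) = 0 := by unfold orient; ring
  have z₂ : orient s' (pt t) (pt t) = 0 := by unfold orient; ring
  have z₃ : orient s' s (pt t) = -orient (pt t) s s' := by unfold orient; ring
  have eneg : orient (-pt t) (-s) (-s') = orient (pt t) s s' := by rw [on, neg_neg]
  have hup' : convexHull ℝ (insert (-pt t) (insert (pt t) (A ∪ -A))) ⊆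
      convexHull ℝ (insert (pt t) (A ∪ -A)) ∪ convexHull ℝ {-pt t, -s, -s'} := by
    refine convexHull_insert_subset_union_triangle (Set.mem_insert_of_mem _ (hneg s hs))
      (Set.mem_insert_of_mem _ (hneg s' hs')) (eneg ▸ e) ?_ ?_ ?_
    · rintro y (rfl | hy)
      · rw [on, om _ _ _ s, z₁]
        have := e₁ s hs
        have := e₁ _ (hneg s hs)
        linarith
      · rw [on]; exact e₁ _ (hneg y hy)
    · rintro y (rfl | hy)
      · rw [on, om _ _ _ s, z₂]
        have := e₂ s hs
        have := e₂ _ (hneg s hs)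
        linarith
      · rw [on]; exact e₂ _ (hneg y hy)
    · rintro y (rfl | hy)
      · rw [on, om _ _ _ s, z₃]
        have := e₃ s hs
        have := e₃ _ (hneg s hs)
        linarith
      · rw [on]; exact e₃ _ (hneg y hy)
  have v₁ := (measure_mono (μ := volume) hup).trans (measure_union_le _ _)
  have v₂ := (measure_mono (μ := volume) hup').trans (measure_union_le _ _)
  rw [volume_triangle, abs_of_pos e] at v₁
  rw [volume_triangle, eneg, abs_of_pos e] at v₂
  rw [hset]
  set V := volume stdTriangle
  calc _ ≤ _ := v₂
    _ ≤ (2 * volume (convexHull ℝ A) + ENNReal.ofReal (orient (pt t) s s') * V) +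
        ENNReal.ofReal (orient (pt t) s s') * V := by
      gcongr; exact v₁.trans (by gcongr)
    _ ≤ (2 * volume (convexHull ℝ A) + ENNReal.ofReal (orient (pt t) p p') * V) +
        ENNReal.ofReal (orient (pt t) p p') * V := by gcongr
    _ = 2 * (volume (convexHull ℝ A) + ENNReal.ofReal (orient (pt t) p p') * V) := by ring
    _ ≤ _ := by gcongr

theorem orient_zero_lt_add {a b c : ℝ × ℝ} (ha : a.1 ^ 2 + a.2 ^ 2 = 1)
    (hb : b.1 ^ 2 + b.2 ^ 2 = 1) (hc : c.1 ^ 2 + c.2 ^ 2 = 1)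
    (hbc : 0 < orient 0 b c) (hca : 0 < orient 0 c a) :
    orient 0 a b < orient 0 b c + orient 0 c a := by
  have neg_lt {x y : ℝ × ℝ} (hx : x.1 ^ 2 + x.2 ^ 2 = 1) (hy : y.1 ^ 2 + y.2 ^ 2 = 1)
      (h : 0 < orient 0 x y) : -1 < x.1 * y.1 + x.2 * y.2 := by
    have e : (x.1 * y.1 + x.2 * y.2) ^ 2 + orient 0 x y ^ 2 = 1 := by
      simp only [orient, Prod.fst_zero, Prod.snd_zero]
      linear_combination (y.1 ^ 2 + y.2 ^ 2) * hx + hy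
    nlinarith [pow_pos h 2]
  have e : orient 0 a b = -orient 0 c a * (b.1 * c.1 + b.2 * c.2) -
      (c.1 * a.1 + c.2 * a.2) * orient 0 b c := by
    simp only [orient, Prod.fst_zero, Prod.snd_zero]
    linear_combination (a.2 * b.1 - a.1 * b.2) * hc
  nlinarith [mul_pos hca (by linarith [neg_lt hb hc hbc] : 0 < b.1 * c.1 + b.2 * c.2 + 1),
    mul_pos hbc (by linarith [neg_lt hc ha hca] : 0 < c.1 * a.1 + c.2 * a.2 + 1)]

theorem volume_symmetrization_triangle_le {a b c : ℝ × ℝ} (ha : a.1 ^ 2 + a.2 ^ 2 = 1)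
    (hb : b.1 ^ 2 + b.2 ^ 2 = 1) (hc : c.1 ^ 2 + c.2 ^ 2 = 1)
    (hab : 0 < orient 0 a b) (hbc : 0 < orient 0 b c) (hca : 0 < orient 0 c a) :
    volume (convexHull ℝ ({a, b, c} ∪ -{a, b, c})) ≤ 2 * volume (convexHull ℝ {a, b, c}) := by
  have fab := orient_zero_lt_add ha hb hc hbc hca
  have fbc := orient_zero_lt_add hb hc ha hca hab
  have fca := orient_zero_lt_add hc ha hb hab hbc
  have hset : ({a, b, c} ∪ -{a, b, c} : Set (ℝ × ℝ)) =
      insert (-b) (insert (-a) (insert (-c) {a, b, c})) := by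
    ext y
    simp only [Set.mem_union, Set.mem_insert_iff, Set.mem_neg, Set.mem_singleton_iff,
      neg_eq_iff_eq_neg]
    tauto
  have D₀ : orient a b c = orient 0 a b + orient 0 b c + orient 0 c a := by
    simp only [orient, Prod.fst_zero, Prod.snd_zero]; ring
  have D₁ : orient (-c) b a = orient 0 b c + orient 0 c a - orient 0 a b := by
    simp only [orient, Prod.fst_zero, Prod.snd_zero, Prod.fst_neg, Prod.snd_neg]; ring
  have D₂ : orient (-a) c b = orient 0 c a + orient 0 a b - orient 0 b c := by
    simp only [orient, Prod.fst_zero, Prod.snd_zero, Prod.fst_neg, Prod.snd_neg]; ring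
  have D₃ : orient (-b) a c = orient 0 a b + orient 0 b c - orient 0 c a := by
    simp only [orient, Prod.fst_zero, Prod.snd_zero, Prod.fst_neg, Prod.snd_neg]; ring
  have p₁ : 0 < orient (-c) b a := by linarith
  have p₂ : 0 < orient (-a) c b := by linarith
  have p₃ : 0 < orient (-b) a c := by linarith
  have s₁ : convexHull ℝ (insert (-c) {a, b, c}) ⊆
      convexHull ℝ {a, b, c} ∪ convexHull ℝ {-c, b, a} := by
    apply convexHull_insert_subset_union_triangle (by simp) (by simp) p₁ <;>
    rintro y (rfl | rfl | rfl) <;>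
    simp only [orient, Prod.fst_zero, Prod.snd_zero, Prod.fst_neg, Prod.snd_neg] at * <;>
    linarith
  have s₂ : convexHull ℝ (insert (-a) (insert (-c) {a, b, c})) ⊆
      convexHull ℝ (insert (-c) {a, b, c}) ∪ convexHull ℝ {-a, c, b} := by
    apply convexHull_insert_subset_union_triangle (by simp) (by simp) p₂ <;>
    rintro y (rfl | rfl | rfl | rfl) <;>
    simp only [orient, Prod.fst_zero, Prod.snd_zero, Prod.fst_neg, Prod.snd_neg] at * <;>
    linarith
  have s₃ : convexHull ℝ (insert (-b) (insert (-a) (insert (-c) {a, b, c}))) ⊆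
      convexHull ℝ (insert (-a) (insert (-c) {a, b, c})) ∪ convexHull ℝ {-b, a, c} := by
    apply convexHull_insert_subset_union_triangle (by simp) (by simp) p₃ <;>
    rintro y (rfl | rfl | rfl | rfl | rfl) <;>
    simp only [orient, Prod.fst_zero, Prod.snd_zero, Prod.fst_neg, Prod.snd_neg] at * <;>
    linarith
  have v₁ := (measure_mono (μ := volume) s₁).trans (measure_union_le _ _)
  have v₂ := (measure_mono (μ := volume) s₂).trans (measure_union_le _ _)
  have v₃ := (measure_mono (μ := volume) s₃).trans (measure_union_le _ _)
  have hsum : ENNReal.ofReal (orient (-c) b a) + ENNReal.ofReal (orient (-a) c b) +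
      ENNReal.ofReal (orient (-b) a c) = ENNReal.ofReal (orient a b c) := by
    rw [← ENNReal.ofReal_add p₁.le p₂.le, ← ENNReal.ofReal_add (by positivity) p₃.le,
      D₀, D₁, D₂, D₃]
    congr 1
    ring
  rw [volume_triangle (-c) b a, abs_of_pos p₁] at v₁
  rw [volume_triangle (-a) c b, abs_of_pos p₂] at v₂
  rw [volume_triangle (-b) a c, abs_of_pos p₃] at v₃
  have v₀ := volume_triangle a b c
  rw [abs_of_pos (by linarith : 0 < orient a b c), ← hsum] at v₀
  set V := volume stdTriangle
  rw [hset]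
  calc _ ≤ _ := v₃
    _ ≤ ((volume (convexHull ℝ {a, b, c}) + ENNReal.ofReal (orient (-c) b a) * V) +
        ENNReal.ofReal (orient (-a) c b) * V) + ENNReal.ofReal (orient (-b) a c) * V := by
      gcongr
      exact v₂.trans (by gcongr)
    _ = volume (convexHull ℝ {a, b, c}) + (ENNReal.ofReal (orient (-c) b a) +
        ENNReal.ofReal (orient (-a) c b) + ENNReal.ofReal (orient (-b) a c)) * V := by ring
    _ = _ := by rw [← v₀, two_mul]

theorem zero_mem_convexHull_of_orient_pos {a b c : ℝ × ℝ} (hab : 0 < orient 0 a b)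
    (hbc : 0 < orient 0 b c) (hca : 0 < orient 0 c a) :
    (0 : ℝ × ℝ) ∈ convexHull ℝ {a, b, c} := by
  refine mem_triangle_of_orient_nonneg ?_ ?_ ?_ ?_ <;>
  simp only [orient, Prod.fst_zero, Prod.snd_zero] at * <;> linarith

theorem volume_symmetrization_le {A : Set (ℝ × ℝ)} (hA : A.Finite)
    (hu : ∀ y ∈ A, y.1 ^ 2 + y.2 ^ 2 = 1) {a b c : ℝ × ℝ} (ha : a ∈ A) (hb : b ∈ A) (hc : c ∈ A)
    (hab : 0 < orient 0 a b) (hbc : 0 < orient 0 b c) (hca : 0 < orient 0 c a) :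
    volume (convexHull ℝ (A ∪ -A)) ≤ 2 * volume (convexHull ℝ A) := by
  have hT : ∀ y ∈ ({a, b, c} : Set (ℝ × ℝ)), y ∈ A := by
    rintro y (rfl | rfl | rfl) <;> assumption
  have h0 := zero_mem_convexHull_of_orient_pos hab hbc hca
  have key (B : Set (ℝ × ℝ)) (hB : B.Finite) : B ⊆ A →
      volume (convexHull ℝ (({a, b, c} ∪ B) ∪ -({a, b, c} ∪ B))) ≤
        2 * volume (convexHull ℝ ({a, b, c} ∪ B)) := by
    induction B, hB using Set.Finite.induction_on with
    | empty =>
      intro _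
      rw [Set.union_empty]
      exact volume_symmetrization_triangle_le (hu a ha) (hu b hb) (hu c hc) hab hbc hca
    | @insert q B _ hB ih =>
      intro hBA
      rw [Set.insert_subset_iff] at hBA
      rw [Set.union_insert]
      refine volume_symmetrization_insert_le ((Set.toFinite _).union hB) ?_
        (convexHull_mono Set.subset_union_left h0) (hu q hBA.1) (ih hBA.2)
      rintro y (hy | hy)
      · exact hu y (hT y hy)
      · exact hu y (hBA.2 hy)
  have := key A hA subset_rfl
  rwa [Set.union_eq_self_of_subset_left (show {a, b, c} ⊆ A from hT)] at this

theorem exists_orient_pos_of_zero_mem_convexHull {A : Set (ℝ × ℝ)}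
    (hu : ∀ y ∈ A, y.1 ^ 2 + y.2 ^ 2 = 1)
    (hA : ∀ x ∈ A, ∀ y ∈ A, orient 0 x y = 0 → x = y) (h0 : (0 : ℝ × ℝ) ∈ convexHull ℝ A) :
    ∃ a ∈ A, ∃ b ∈ A, ∃ c ∈ A,
      0 < orient 0 a b ∧ 0 < orient 0 b c ∧ 0 < orient 0 c a := by
  obtain ⟨ι, _, z, w, hz, hind, hw, hw1, hwz⟩ := eq_pos_convex_span_of_mem_convexHull h0
  replace hz (i : ι) : z i ∈ A := hz ⟨i, rfl⟩
  have hcard : Fintype.card ι ≤ 3 := by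
    refine hind.card_le_finrank_succ.trans ?_
    have := Submodule.finrank_le (vectorSpan ℝ (Set.range z))
    simp only [Module.finrank_prod, Module.finrank_self] at this
    omega
  obtain ⟨n, hn⟩ : ∃ n, n = Fintype.card ι := ⟨_, rfl⟩
  let e : Fin n ≃ ι := (Fintype.equivFinOfCardEq hn.symm).symm
  rw [← e.sum_comp] at hw1 hwz
  have hinj : Function.Injective (z ∘ e) := hind.injective.comp e.injective
  rw [← hn] at hcard
  interval_cases n
  · simp at hw1
  · simp only [Finset.univ_unique, Fin.default_eq_zero, Finset.sum_singleton] at hw1 hwz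
    rw [hw1, one_smul] at hwz
    have := hu _ (hz (e 0))
    rw [hwz] at this
    simp at this
  · simp only [Fin.sum_univ_two, Prod.ext_iff, Prod.fst_add, Prod.snd_add, Prod.smul_fst,
      Prod.smul_snd, smul_eq_mul, Prod.fst_zero, Prod.snd_zero] at hwz
    obtain ⟨h₁, h₂⟩ := hwz
    have hc : w (e 1) * orient 0 (z (e 0)) (z (e 1)) = 0 := by
      simp only [orient, Prod.fst_zero, Prod.snd_zero]
      linear_combination (z (e 0)).1 * h₂ - (z (e 0)).2 * h₁
    have := hinj (hA _ (hz _) _ (hz _) ((mul_eq_zero.1 hc).resolve_left (hw _).ne'))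
    simp at this
  · simp only [Fin.sum_univ_three, Prod.ext_iff, Prod.fst_add, Prod.snd_add, Prod.smul_fst,
      Prod.smul_snd, smul_eq_mul, Prod.fst_zero, Prod.snd_zero] at hwz
    obtain ⟨h₁, h₂⟩ := hwz
    have hne : orient 0 (z (e 0)) (z (e 1)) ≠ 0 := by
      intro h
      have := hinj (hA _ (hz _) _ (hz _) h)
      simp at this
    have ha := hz (e 0)
    have hb := hz (e 1)
    have hc := hz (e 2)
    have wa := hw (e 0)
    have wb := hw (e 1)
    have wc := hw (e 2)
    generalize z (e 0) = a at *
    generalize z (e 1) = b at *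
    generalize z (e 2) = c at *
    generalize w (e 0) = α at *
    generalize w (e 1) = β at *
    generalize w (e 2) = γ at *
    have r₁ : γ * orient 0 c a = β * orient 0 a b := by
      simp only [orient, Prod.fst_zero, Prod.snd_zero]
      linear_combination a.2 * h₁ - a.1 * h₂
    have r₂ : γ * orient 0 b c = α * orient 0 a b := by
      simp only [orient, Prod.fst_zero, Prod.snd_zero]
      linear_combination b.1 * h₂ - b.2 * h₁
    have sw (x y : ℝ × ℝ) : orient 0 x y = -orient 0 y x := by
      simp only [orient, Prod.fst_zero, Prod.snd_zero]; ring
    rcases hne.lt_or_gt with h | h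
    · refine ⟨b, hb, a, ha, c, hc, by rw [sw]; linarith, ?_, ?_⟩
      · rw [sw, neg_pos]
        have := mul_neg_of_pos_of_neg wb h
        by_contra! h'
        have := mul_nonneg wc.le h'
        linarith
      · rw [sw, neg_pos]
        have := mul_neg_of_pos_of_neg wa h
        by_contra! h'
        have := mul_nonneg wc.le h'
        linarith
    · refine ⟨a, ha, b, hb, c, hc, h, ?_, ?_⟩
      · exact pos_of_mul_pos_right (r₂ ▸ mul_pos wa h) wc.le
      · exact pos_of_mul_pos_right (r₁ ▸ mul_pos wb h) wc.le

theorem vtx_sq_add_sq {n : ℕ} (θ : Fin n → ℝ) (ε : Fin n → Bool) (i : Fin n) :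
    (vtx θ ε i).1 ^ 2 + (vtx θ ε i).2 ^ 2 = 1 := by
  unfold vtx
  split_ifs <;> simp [pt]

theorem eq_of_orient_zero_vtx_eq_zero {n : ℕ} {θ : Fin n → ℝ} (hmono : StrictMono θ)
    (hrange : ∀ i, θ i ∈ Set.Ico 0 Real.pi) (ε : Fin n → Bool) {i j : Fin n}
    (h : orient 0 (vtx θ ε i) (vtx θ ε j) = 0) : i = j := by
  have hs : Real.sin (θ j - θ i) = 0 := by
    unfold vtx at h
    rw [Real.sin_sub]
    split_ifs at h <;>
    simp only [orient, pt, Prod.fst_zero, Prod.snd_zero, Prod.fst_neg, Prod.snd_neg] at h <;>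
    linarith
  have hi := hrange i
  have hj := hrange j
  rw [Real.sin_eq_zero_iff_of_lt_of_lt (by linarith [hi.2, hj.1]) (by linarith [hi.1, hj.2])] at hs
  exact hmono.injective (by linarith)

theorem zero_mem_apoly_of_not_thin {n : ℕ} (hn : 0 < n) {θ : Fin n → ℝ} {ε : Fin n → Bool}
    (h : ¬ Thin θ ε) : (0 : ℝ × ℝ) ∈ apoly θ ε := by
  by_contra h0
  obtain ⟨f, u, hf0, hfu⟩ := geometric_hahn_banach_point_closed (convex_convexHull ℝ _)
    ((Set.finite_range (vtx θ ε)).isCompact_convexHull ℝ).isClosed h0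
  rw [map_zero] at hf0
  have hf (x : ℝ × ℝ) : dotp (f (1, 0), f (0, 1)) x = f x := by
    conv_rhs => rw [show x = x.1 • ((1 : ℝ), (0 : ℝ)) + x.2 • ((0 : ℝ), (1 : ℝ)) by ext <;> simp]
    rw [map_add, map_smul, map_smul, dotp, smul_eq_mul, smul_eq_mul]
    ring
  have hpos (i : Fin n) : 0 < f (vtx θ ε i) :=
    hf0.trans (hfu _ (subset_convexHull ℝ _ ⟨i, rfl⟩))
  refine h ⟨(f (1, 0), f (0, 1)), fun hv => ?_, fun i => by rw [hf]; exact (hpos i).le⟩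
  have := hf (vtx θ ε ⟨0, hn⟩)
  rw [hv] at this
  have := hpos ⟨0, hn⟩
  simp [dotp] at *
  linarith

theorem Thin.zero_notMem_apoly {n : ℕ} {θ : Fin n → ℝ} (hmono : StrictMono θ)
    (hrange : ∀ i, θ i ∈ Set.Ico 0 Real.pi) {ε : Fin n → Bool} (h : Thin θ ε) :
    (0 : ℝ × ℝ) ∉ apoly θ ε := by
  intro h0
  obtain ⟨_, ⟨i, rfl⟩, _, ⟨j, rfl⟩, _, ⟨k, rfl⟩, hab, hbc, hca⟩ :=
    exists_orient_pos_of_zero_mem_convexHull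
      (by rintro _ ⟨i, rfl⟩; exact vtx_sq_add_sq θ ε i)
      (by
        rintro _ ⟨i, rfl⟩ _ ⟨j, rfl⟩ hij
        rw [eq_of_orient_zero_vtx_eq_zero hmono hrange ε hij]) h0
  obtain ⟨v, hv, hvtx⟩ := h
  have hi := hvtx i
  have hj := hvtx j
  have hk := hvtx k
  generalize vtx θ ε i = a at *
  generalize vtx θ ε j = b at *
  generalize vtx θ ε k = c at *
  have hsum : orient 0 b c * dotp v a + orient 0 c a * dotp v b + orient 0 a b * dotp v c = 0 := by
    simp only [orient, dotp, Prod.fst_zero, Prod.snd_zero]; ring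
  have m₁ := mul_nonneg hbc.le hi
  have m₂ := mul_nonneg hca.le hj
  have m₃ := mul_nonneg hab.le hk
  have za : dotp v a = 0 :=
    (mul_eq_zero.1 (by linarith : orient 0 b c * dotp v a = 0)).resolve_left hbc.ne'
  have zb : dotp v b = 0 :=
    (mul_eq_zero.1 (by linarith : orient 0 c a * dotp v b = 0)).resolve_left hca.ne'
  have v₁ : orient 0 a b * v.1 = 0 := by
    have : orient 0 a b * v.1 = dotp v a * b.2 - dotp v b * a.2 := by
      simp only [orient, dotp, Prod.fst_zero, Prod.snd_zero]; ring
    rw [this, za, zb]; ring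
  have v₂ : orient 0 a b * v.2 = 0 := by
    have : orient 0 a b * v.2 = dotp v b * a.1 - dotp v a * b.1 := by
      simp only [orient, dotp, Prod.fst_zero, Prod.snd_zero]; ring
    rw [this, za, zb]; ring
  exact hv (Prod.ext ((mul_eq_zero.1 v₁).resolve_left hab.ne')
    ((mul_eq_zero.1 v₂).resolve_left hab.ne'))

/-- A compact convex set `K` missing the origin occupies less than half of any set that contains
`K`, `-K` and a neighbourhood of the origin. -/
theorem two_mul_volume_lt {K Q : Set (ℝ × ℝ)} (hK : IsCompact K) (hconv : Convex ℝ K)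
    (h0 : (0 : ℝ × ℝ) ∉ K) (hKQ : K ⊆ Q) (hKQ' : -K ⊆ Q) (hQ : Q ∈ nhds 0) :
    2 * volume K < volume Q := by
  have h0' : (0 : ℝ × ℝ) ∉ -K := by simpa using h0
  have hdisj : Disjoint K (-K) := by
    rw [Set.disjoint_left]
    intro x hx hx'
    apply h0
    have := hconv hx hx' (by norm_num : (0 : ℝ) ≤ 1 / 2) (by norm_num : (0 : ℝ) ≤ 1 / 2)
      (by norm_num)
    simpa using this
  have hcl : IsClosed (K ∪ -K) := hK.isClosed.union hK.neg.isClosed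
  have hU : Q ∩ (K ∪ -K)ᶜ ∈ nhds (0 : ℝ × ℝ) :=
    Filter.inter_mem hQ (hcl.isOpen_compl.mem_nhds (by simp [h0]))
  have hpos : 0 < volume (Q ∩ (K ∪ -K)ᶜ) := Measure.measure_pos_of_mem_nhds _ hU
  have hvol : volume (K ∪ -K) = 2 * volume K := by
    rw [measure_union hdisj hK.neg.isClosed.measurableSet, Measure.measure_neg, two_mul]
  have hfin : 2 * volume K ≠ ⊤ := ENNReal.mul_ne_top (by simp) hK.measure_lt_top.ne
  calc 2 * volume K < 2 * volume K + volume (Q ∩ (K ∪ -K)ᶜ) :=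
        ENNReal.lt_add_right hfin hpos.ne'
    _ = volume ((K ∪ -K) ∪ (Q ∩ (K ∪ -K)ᶜ)) := by
        rw [measure_union' (Set.disjoint_left.2 fun x hx hx' => hx'.2 hx) hcl.measurableSet, hvol]
    _ ≤ volume Q := measure_mono
        (Set.union_subset (Set.union_subset hKQ hKQ') Set.inter_subset_left)

theorem triangle_mem_nhds_zero {a b c : ℝ × ℝ} (hab : 0 < orient 0 a b)
    (hbc : 0 < orient 0 b c) (hca : 0 < orient 0 c a) :
    convexHull ℝ {a, b, c} ∈ nhds (0 : ℝ × ℝ) := by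
  have hcont (x y : ℝ × ℝ) : Continuous (orient x y) := by unfold orient; fun_prop
  have hnear (x y : ℝ × ℝ) (h : 0 < orient 0 x y) :
      ∀ᶠ z in nhds (0 : ℝ × ℝ), 0 < orient x y z := by
    rw [orient_rotate] at h
    exact (hcont x y).continuousAt.eventually (lt_mem_nhds h)
  filter_upwards [hnear a b hab, hnear b c hbc, hnear c a hca] with x h₁ h₂ h₃
  refine mem_triangle_of_orient_nonneg ?_ h₁.le h₂.le h₃.le
  simp only [orient, Prod.fst_zero, Prod.snd_zero] at *
  linarith

/-- Every thin antipodal polygon has strictly smaller area than every non-thin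
antipodal polygon. -/
theorem stmt_6 (n : ℕ) (hn : 3 ≤ n) (θ : Fin n → ℝ) (hmono : StrictMono θ)
    (hrange : ∀ i, θ i ∈ Set.Ico 0 Real.pi)
    (ε ε' : Fin n → Bool) (h : Thin θ ε) (h' : ¬ Thin θ ε') :
    volume (apoly θ ε) < volume (apoly θ ε') := by
  have hsub (δ δ' : Fin n → Bool) :
      Set.range (vtx θ δ) ⊆ Set.range (vtx θ δ') ∪ -Set.range (vtx θ δ') := by
    rintro _ ⟨i, rfl⟩
    by_cases hi : δ i = δ' i
    · exact Or.inl ⟨i, by simp [vtx, hi]⟩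
    · refine Or.inr ⟨i, ?_⟩
      unfold vtx
      cases h₁ : δ i <;> cases h₂ : δ' i <;> simp_all
  have hneg : -Set.range (vtx θ ε) ⊆ Set.range (vtx θ ε') ∪ -Set.range (vtx θ ε') := by
    intro x hx
    simpa only [Set.mem_union, Set.mem_neg, neg_neg, or_comm] using hsub ε ε' hx
  obtain ⟨a, ha, b, hb, c, hc, hab, hbc, hca⟩ :=
    exists_orient_pos_of_zero_mem_convexHull
      (by rintro _ ⟨i, rfl⟩; exact vtx_sq_add_sq θ ε' i)
      (by
        rintro _ ⟨i, rfl⟩ _ ⟨j, rfl⟩ hij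
        rw [eq_of_orient_zero_vtx_eq_zero hmono hrange ε' hij])
      (zero_mem_apoly_of_not_thin (by omega) h')
  have hle := volume_symmetrization_le (Set.finite_range (vtx θ ε'))
    (by rintro _ ⟨i, rfl⟩; exact vtx_sq_add_sq θ ε' i) ha hb hc hab hbc hca
  have hlt := two_mul_volume_lt (Q := convexHull ℝ (Set.range (vtx θ ε') ∪ -Set.range (vtx θ ε')))
    ((Set.finite_range (vtx θ ε)).isCompact_convexHull ℝ) (convex_convexHull ℝ _)
    (h.zero_notMem_apoly hmono hrange) (convexHull_mono (hsub ε ε'))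
    (by rw [← convexHull_neg]; exact convexHull_mono hneg)
    (Filter.mem_of_superset (triangle_mem_nhds_zero hab hbc hca) (convexHull_mono (by
      rintro z (rfl | rfl | rfl)
      exacts [Or.inl ha, Or.inl hb, Or.inl hc])))
  exact lt_of_mul_lt_mul_left' (hlt.trans_le hle)
end

section
/- Let S be an antipodal point set of 2n points on the unit circle and let P be an antipodal polygon on S containing three consecutive points q₁, q₂, q₃ of the circular order of S as vertices. Let P' be the antipodal polygon obtained from P by replacing q₂ with its antipode -q₂. Then Area(P') > Area(P). -/
open MeasureTheory

/-- The determinant of the vectors `y - x` and `z - x`: twice the signed area of a triangle. -/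
def cross3 (x y z : ℝ × ℝ) : ℝ :=
  (y.1 - x.1) * (z.2 - x.2) - (z.1 - x.1) * (y.2 - x.2)

theorem isLinearMap_dotp (u : ℝ × ℝ) : IsLinearMap ℝ (dotp u) where
  map_add x y := by simp only [dotp, Prod.fst_add, Prod.snd_add]; ring
  map_smul c x := by simp only [dotp, Prod.smul_fst, Prod.smul_snd, smul_eq_mul]; ring

theorem dotp_pt (x y : ℝ) : dotp (pt x) (pt y) = Real.cos (y - x) := by
  simp only [dotp, pt, Real.cos_sub]; ring

open scoped Pointwise in
theorem volume_convexHull_triple (x y z : ℝ × ℝ) :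
    volume (convexHull ℝ {x, y, z}) = ENNReal.ofReal |cross3 x y z| *
      volume (convexHull ℝ {(0, 0), (1, 0), ((0, 1) : ℝ × ℝ)}) := by
  set f := Matrix.toLin (Module.Basis.finTwoProd ℝ) (Module.Basis.finTwoProd ℝ)
    !![y.1 - x.1, z.1 - x.1; y.2 - x.2, z.2 - x.2] with hf
  have hdet : LinearMap.det f = cross3 x y z := by
    rw [hf, LinearMap.det_toLin, Matrix.det_fin_two_of, cross3]
  have himage : (fun p => -x + p) ⁻¹'
      (f '' convexHull ℝ {(0, 0), (1, 0), ((0, 1) : ℝ × ℝ)}) = convexHull ℝ {x, y, z} := by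
    rw [LinearMap.image_convexHull, ← Set.image_add_left]
    change x +ᵥ convexHull ℝ (f '' _) = _
    rw [← convexHull_vadd]
    simp [Set.image_insert_eq, hf, Matrix.toLin_finTwoProd_apply, Set.vadd_set_insert,
      Prod.add_def]
  rw [← himage, measure_preimage_add, Measure.addHaar_image_linearMap, hdet]

theorem volume_standard_triangle_pos :
    0 < volume (convexHull ℝ {(0, 0), (1, 0), ((0, 1) : ℝ × ℝ)}) := by
  refine Measure.measure_pos_of_nonempty_interior _ ⟨(1 / 4, 1 / 4), ?_⟩
  refine mem_interior.2 ⟨Set.Ioo 0 (1 / 2) ×ˢ Set.Ioo 0 (1 / 2), ?_,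
    isOpen_Ioo.prod isOpen_Ioo, by norm_num⟩
  rintro ⟨a, b⟩ ⟨⟨ha, ha'⟩, hb, hb'⟩
  have hmem := (convex_convexHull ℝ {(0, 0), (1, 0), ((0, 1) : ℝ × ℝ)}).sum_mem
    (t := Finset.univ) (w := ![1 - a - b, a, b]) (z := ![(0, 0), (1, 0), (0, 1)])
  simp only at ha ha' hb hb'
  have := hmem ?_ ?_ ?_
  · simpa [Fin.sum_univ_three] using this
  · intro i _
    fin_cases i <;> simp <;> linarith
  · simp only [Fin.sum_univ_three, Matrix.cons_val]
    ring
  · intro i _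
    apply subset_convexHull
    fin_cases i <;> simp

theorem volume_convexHull_lt_top {s : Set (ℝ × ℝ)} (hs : s.Finite) :
    volume (convexHull ℝ s) < ⊤ :=
  (hs.isCompact_convexHull ℝ).measure_lt_top

theorem volume_line (u : ℝ × ℝ) (hu : dotp u u = 1) (c : ℝ) :
    volume {z | dotp u z = c} = 0 := by
  set f := (isLinearMap_dotp u).mk'
  have hf : ∀ z, f z = dotp u z := fun _ => rfl
  have hc : f (c • u) = c := by rw [map_smul, hf, hu, smul_eq_mul, mul_one]
  have hset : {z | dotp u z = c} = (AffineSubspace.mk' (c • u) (LinearMap.ker f) : Set (ℝ × ℝ)) := by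
    ext z
    rw [SetLike.mem_coe, AffineSubspace.mem_mk', LinearMap.mem_ker, vsub_eq_sub, map_sub, hc, hf,
      sub_eq_zero, Set.mem_ofPred_eq]
  rw [hset]
  refine Measure.addHaar_affineSubspace _ _ fun htop => ?_
  have hmem : c • u + u ∈ AffineSubspace.mk' (c • u) (LinearMap.ker f) := by
    rw [htop]; trivial
  rw [AffineSubspace.mem_mk', LinearMap.mem_ker, vsub_eq_sub, add_sub_cancel_left, hf, hu] at hmem
  exact one_ne_zero hmem

theorem cross3_pt (a b c : ℝ) : cross3 (pt a) (pt b) (pt c) =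
    4 * (Real.sin ((b - a) / 2) * Real.sin ((c - b) / 2) * Real.sin ((c - a) / 2)) := by
  obtain ⟨x, rfl⟩ : ∃ x, a = 2 * x := ⟨a / 2, by ring⟩
  obtain ⟨y, rfl⟩ : ∃ x, b = 2 * x := ⟨b / 2, by ring⟩
  obtain ⟨z, rfl⟩ : ∃ x, c = 2 * x := ⟨c / 2, by ring⟩
  simp only [← mul_sub, mul_div_cancel_left₀ _ (two_ne_zero' ℝ), cross3, pt]
  simp only [Real.sin_sub, Real.sin_two_mul, Real.cos_two_mul']
  have hx := Real.sin_sq_add_cos_sq x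
  have hy := Real.sin_sq_add_cos_sq y
  have hz := Real.sin_sq_add_cos_sq z
  generalize Real.sin x = sx at *
  generalize Real.sin y = sy at *
  generalize Real.sin z = sz at *
  generalize Real.cos x = cx at *
  generalize Real.cos y = cy at *
  generalize Real.cos z = cz at *
  grind

theorem convex_unit_disc : Convex ℝ {z : ℝ × ℝ | dotp z z ≤ 1} := by
  rintro ⟨x, y⟩ hx ⟨z, w⟩ hz a b ha hb hab
  simp only [Set.mem_ofPred_eq, dotp, Prod.smul_mk, Prod.mk_add_mk, smul_eq_mul] at *
  obtain rfl : b = 1 - a := by linarith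
  nlinarith [mul_nonneg (mul_nonneg ha hb) (add_nonneg (sq_nonneg (x - z)) (sq_nonneg (y - w))),
    mul_le_mul_of_nonneg_left hx ha, mul_le_mul_of_nonneg_left hz hb]

theorem mem_segment_of_mem_chord {m h : ℝ} (h0 : 0 < h) (hπ : h < Real.pi) {z : ℝ × ℝ}
    (hz : dotp z z ≤ 1) (hd : dotp (pt m) z = Real.cos h) :
    z ∈ segment ℝ (pt (m - h)) (pt (m + h)) := by
  have hσ := Real.sin_pos_of_pos_of_lt_pi h0 hπ
  obtain ⟨x, y⟩ := z
  set s := Real.cos m * y - Real.sin m * x with hs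
  have hm := Real.sin_sq_add_cos_sq m
  have hh := Real.sin_sq_add_cos_sq h
  simp only [dotp, pt] at hz hd
  have hsum : s ^ 2 + Real.cos h ^ 2 = x ^ 2 + y ^ 2 := by
    rw [hs, ← hd]; linear_combination (x ^ 2 + y ^ 2) * hm
  have hle : |s| ≤ Real.sin h := abs_le_of_sq_le_sq (by nlinarith) hσ.le
  rw [abs_le] at hle
  have hx : x = Real.cos m * Real.cos h - Real.sin m * s := by
    rw [hs, ← hd]; linear_combination -x * hm
  have hy : y = Real.sin m * Real.cos h + Real.cos m * s := by
    rw [hs, ← hd]; linear_combination -y * hm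
  refine ⟨(Real.sin h - s) / (2 * Real.sin h), (Real.sin h + s) / (2 * Real.sin h),
    div_nonneg (by linarith) (by linarith), div_nonneg (by linarith) (by linarith),
    by field_simp; ring, ?_⟩
  simp only [pt, Prod.smul_mk, Prod.mk_add_mk, smul_eq_mul, Real.cos_sub, Real.cos_add,
    Real.sin_sub, Real.sin_add]
  rw [hx, hy]
  congr 1 <;> · field_simp; ring

theorem cos_le_cos_of_mem_Icc {h x : ℝ} (h0 : 0 ≤ h) (hx : x ∈ Set.Icc h (2 * Real.pi - h)) :
    Real.cos x ≤ Real.cos h := by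
  obtain ⟨h1, h2⟩ := hx
  rcases le_total x Real.pi with hπ | hπ
  · exact Real.cos_le_cos_of_nonneg_of_le_pi h0 hπ h1
  · rw [← Real.cos_two_pi_sub x]
    exact Real.cos_le_cos_of_nonneg_of_le_pi h0 (by linarith) (by linarith)

theorem cos_lt_cos_of_abs_lt {h x : ℝ} (hh : h ≤ Real.pi) (hx : |x| < h) :
    Real.cos h < Real.cos x := by
  rw [← Real.cos_abs x]
  exact Real.cos_lt_cos_of_nonneg_of_le_pi (abs_nonneg x) hh hx

theorem dotp_pt_self (x : ℝ) : dotp (pt x) (pt x) = 1 := by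
  rw [dotp_pt, sub_self, Real.cos_zero]

/-- If every point of `s` lies on one side of a chord whose endpoints belong to `s`, then adding
a point `q` of the disc beyond the chord enlarges the convex hull by at most one triangle. -/
theorem convexHull_insert_subset_union {m h : ℝ} (h0 : 0 < h) (hπ : h < Real.pi)
    {s : Set (ℝ × ℝ)} (hs : ∀ z ∈ s, dotp z z ≤ 1) (hle : ∀ z ∈ s, dotp (pt m) z ≤ Real.cos h)
    (h1 : pt (m - h) ∈ s) (h2 : pt (m + h) ∈ s) {q : ℝ × ℝ} (hq : dotp q q ≤ 1)
    (hlt : Real.cos h < dotp (pt m) q) :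
    convexHull ℝ (insert q s) ⊆
      convexHull ℝ s ∪ convexHull ℝ {pt (m - h), q, pt (m + h)} := by
  rw [convexHull_insert ⟨_, h1⟩]
  intro z hz
  obtain ⟨q', rfl, w, hw, hz⟩ := mem_convexJoin.1 hz
  have hwle : dotp (pt m) w ≤ Real.cos h :=
    convexHull_min hle (convex_halfSpace_le (isLinearMap_dotp _) _) hw
  have hwd : dotp w w ≤ 1 := convexHull_min hs convex_unit_disc hw
  set τ := (dotp (pt m) q' - Real.cos h) / (dotp (pt m) q' - dotp (pt m) w) with hτ
  have hpos : 0 < dotp (pt m) q' - dotp (pt m) w := by linarith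
  have hτ0 : 0 < τ := div_pos (by linarith) hpos
  have hτ1 : τ ≤ 1 := (div_le_one hpos).2 (by linarith)
  set y := (1 - τ) • q' + τ • w with hy
  have hyd : dotp y y ≤ 1 := convex_unit_disc hq hwd (by linarith) hτ0.le (by ring)
  have hyc : dotp (pt m) y = Real.cos h := by
    rw [hy, (isLinearMap_dotp _).map_add, (isLinearMap_dotp _).map_smul,
      (isLinearMap_dotp _).map_smul, smul_eq_mul, smul_eq_mul]
    linear_combination - div_mul_cancel₀ (dotp (pt m) q' - Real.cos h) hpos.ne'
  have hyseg := mem_segment_of_mem_chord h0 hπ hyd hyc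
  obtain ⟨a, t, ha, ht, hat, rfl⟩ := hz
  obtain rfl : a = 1 - t := by linarith
  rcases le_or_gt t τ with htτ | htτ
  · right
    have hyT : y ∈ convexHull ℝ {pt (m - h), q', pt (m + h)} :=
      segment_subset_convexHull (by simp) (by simp) hyseg
    have hqT : q' ∈ convexHull ℝ {pt (m - h), q', pt (m + h)} :=
      subset_convexHull _ _ (by simp)
    have := convex_convexHull ℝ {pt (m - h), q', pt (m + h)} hqT hyT
      (sub_nonneg.2 ((div_le_one hτ0).2 htτ)) (div_nonneg ht hτ0.le) (by ring)
    convert this using 1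
    have e : t = t / τ * τ := (div_mul_cancel₀ _ hτ0.ne').symm
    rw [hy]
    nth_rewrite 1 2 [e]
    module
  · left
    have hyQ : y ∈ convexHull ℝ s := segment_subset_convexHull h1 h2 hyseg
    have h1τ : 0 < 1 - τ := by linarith
    have := convex_convexHull ℝ s hyQ hw (div_nonneg ha h1τ.le)
      (sub_nonneg.2 ((div_le_one h1τ).2 (by linarith : 1 - t ≤ 1 - τ))) (by ring)
    convert this using 1
    have e : 1 - t = (1 - t) / (1 - τ) * (1 - τ) := (div_mul_cancel₀ _ h1τ.ne').symm
    obtain ⟨r, hr⟩ : ∃ r, r = (1 - t) / (1 - τ) := ⟨_, rfl⟩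
    rw [← hr] at e ⊢
    obtain rfl : t = 1 - r * (1 - τ) := by linarith
    rw [hy]
    module

/-- Among the points at angles `Φ`, the endpoints of the gap around `B + π` are at angles `a`
and `b`. -/
theorem exists_gap {Φ : Finset ℝ} {A C : ℝ} (hCA : C < A + Real.pi) (hC : C ∈ Φ)
    (hA : A + 2 * Real.pi ∈ Φ)
    (hΦ : ∀ φ ∈ Φ, φ ∈ Set.Ico C (A + Real.pi) ∨ φ ∈ Set.Ioc (C + Real.pi) (A + 2 * Real.pi)) :
    ∃ a ∈ Φ, ∃ b ∈ Φ, a ∈ Set.Ico C (A + Real.pi) ∧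
      b ∈ Set.Ioc (C + Real.pi) (A + 2 * Real.pi) ∧
      ∀ φ ∈ Φ, φ ∈ Set.Icc C a ∨ φ ∈ Set.Icc b (A + 2 * Real.pi) := by
  obtain ⟨a, ha, hmax⟩ := (Φ.filter (· ∈ Set.Ico C (A + Real.pi))).exists_max_image id
    ⟨C, by simp [hC, hCA]⟩
  obtain ⟨b, hb, hmin⟩ := (Φ.filter (· ∈ Set.Ioc (C + Real.pi) (A + 2 * Real.pi))).exists_min_image
    id ⟨A + 2 * Real.pi, Finset.mem_filter.2 ⟨hA, by constructor <;> linarith⟩⟩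
  rw [Finset.mem_filter] at ha hb
  refine ⟨a, ha.1, b, hb.1, ha.2, hb.2, fun φ hφ => (hΦ φ hφ).imp (fun h => ⟨h.1, ?_⟩)
    fun h => ⟨?_, h.2⟩⟩
  · exact hmax φ (Finset.mem_filter.2 ⟨hφ, h⟩)
  · exact hmin φ (Finset.mem_filter.2 ⟨hφ, h⟩)

theorem abs_cross3_pt_lt {A B C a b : ℝ} (hAB : A < B) (hBC : B < C)
    (ha : a ∈ Set.Ico C (A + Real.pi)) (hb : b ∈ Set.Ioc (C + Real.pi) (A + 2 * Real.pi)) :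
    |cross3 (pt A) (pt B) (pt C)| < |cross3 (pt a) (pt (B + Real.pi)) (pt b)| := by
  obtain ⟨ha1, ha2⟩ := ha
  obtain ⟨hb1, hb2⟩ := hb
  have hπ := Real.pi_pos
  have hx0 : 0 < Real.sin ((B - A) / 2) := Real.sin_pos_of_pos_of_lt_pi (by linarith) (by linarith)
  have hy0 : 0 < Real.sin ((C - B) / 2) := Real.sin_pos_of_pos_of_lt_pi (by linarith) (by linarith)
  have hz0 : 0 < Real.sin ((C - A) / 2) := Real.sin_pos_of_pos_of_lt_pi (by linarith) (by linarith)
  have hx : Real.sin ((B - A) / 2) < Real.sin ((B + Real.pi - a) / 2) :=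
    Real.sin_lt_sin_of_lt_of_le_pi_div_two (by linarith) (by linarith) (by linarith)
  have hy : Real.sin ((C - B) / 2) < Real.sin ((b - (B + Real.pi)) / 2) :=
    Real.sin_lt_sin_of_lt_of_le_pi_div_two (by linarith) (by linarith) (by linarith)
  have hz : Real.sin ((C - A) / 2) ≤ Real.sin ((b - a) / 2) := by
    rw [← Real.cos_sub_pi_div_two, ← Real.cos_sub_pi_div_two ((b - a) / 2),
      ← Real.cos_abs (_ - _), ← Real.cos_abs ((b - a) / 2 - _)]
    refine Real.cos_le_cos_of_nonneg_of_le_pi (abs_nonneg _) ?_ ?_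
    · rw [abs_le]; constructor <;> linarith
    · rw [abs_of_nonpos (by linarith : (C - A) / 2 - Real.pi / 2 ≤ 0), abs_le]
      constructor <;> linarith
  rw [cross3_pt, cross3_pt, abs_of_pos (by positivity),
    abs_of_pos (mul_pos four_pos
      (mul_pos (mul_pos (hx0.trans hx) (hy0.trans hy)) (hz0.trans_le hz)))]
  refine mul_lt_mul_of_pos_left ?_ four_pos
  exact mul_lt_mul (mul_lt_mul hx hy.le hy0 (hx0.trans hx).le) hz hz0
    (mul_pos (hx0.trans hx) (hy0.trans hy)).le

theorem volume_convexHull_insert_antipode {Φ : Finset ℝ} {A B C : ℝ} (hAB : A < B) (hBC : B < C)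
    (hCA : C < A + Real.pi) (hC : C ∈ Φ) (hA : A + 2 * Real.pi ∈ Φ)
    (hΦ : ∀ φ ∈ Φ, φ ∈ Set.Ico C (A + Real.pi) ∨ φ ∈ Set.Ioc (C + Real.pi) (A + 2 * Real.pi)) :
    volume (convexHull ℝ (insert (pt B) (pt '' Φ))) <
      volume (convexHull ℝ (insert (pt (B + Real.pi)) (pt '' Φ))) := by
  obtain ⟨a, haΦ, b, hbΦ, ha, hb, hab⟩ := exists_gap hCA hC hA hΦ
  have hπ := Real.pi_pos
  have hfin : (pt '' (Φ : Set ℝ)).Finite := Φ.finite_toSet.image _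
  have hupper : volume (convexHull ℝ (insert (pt B) (pt '' Φ))) ≤
      volume (convexHull ℝ (pt '' Φ)) + volume (convexHull ℝ {pt A, pt B, pt C}) := by
    have hA' : (A + C) / 2 - (C - A) / 2 = A := by ring
    have hC' : (A + C) / 2 + (C - A) / 2 = C := by ring
    have hsub := convexHull_insert_subset_union (m := (A + C) / 2) (h := (C - A) / 2)
      (s := pt '' Φ) (q := pt B) (by linarith) (by linarith) ?_ ?_ ?_ ?_ (dotp_pt_self B).le ?_
    · rw [hA', hC'] at hsub
      exact (measure_mono hsub).trans (measure_union_le _ _)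
    · rintro _ ⟨φ, -, rfl⟩
      exact (dotp_pt_self φ).le
    · rintro _ ⟨φ, hφ, rfl⟩
      rw [dotp_pt]
      refine cos_le_cos_of_mem_Icc (by linarith) ?_
      rcases hΦ φ hφ with ⟨h1, h2⟩ | ⟨h1, h2⟩ <;> constructor <;> linarith
    · rw [hA']
      exact ⟨A + 2 * Real.pi, hA, by simp [pt]⟩
    · rw [hC']
      exact ⟨C, hC, rfl⟩
    · rw [dotp_pt]
      refine cos_lt_cos_of_abs_lt (by linarith) ?_
      rw [abs_lt]
      constructor <;> linarith
  have hlower : volume (convexHull ℝ (pt '' Φ)) +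
      volume (convexHull ℝ {pt a, pt (B + Real.pi), pt b}) ≤
      volume (convexHull ℝ (insert (pt (B + Real.pi)) (pt '' Φ))) := by
    set u := pt ((a + b) / 2)
    have hQ : convexHull ℝ (pt '' Φ) ⊆ {z | dotp u z ≤ Real.cos ((b - a) / 2)} := by
      refine convexHull_min ?_ (convex_halfSpace_le (isLinearMap_dotp _) _)
      rintro _ ⟨φ, hφ, rfl⟩
      rw [Set.mem_ofPred_eq, dotp_pt]
      rcases hab φ hφ with h | h
      · rw [← Real.cos_add_two_pi]
        refine cos_le_cos_of_mem_Icc ?_ ⟨?_, ?_⟩ <;> linarith [h.1, h.2, ha.2, hb.1, hb.2]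
      · refine cos_le_cos_of_mem_Icc ?_ ⟨?_, ?_⟩ <;> linarith [h.1, h.2, ha.1, ha.2, hb.1, hb.2]
    have hT : convexHull ℝ {pt a, pt (B + Real.pi), pt b} ⊆
        {z | Real.cos ((b - a) / 2) ≤ dotp u z} := by
      refine convexHull_min ?_ (convex_halfSpace_ge (isLinearMap_dotp _) _)
      rintro _ (rfl | rfl | rfl)
      · rw [Set.mem_ofPred_eq, dotp_pt, ← Real.cos_neg]
        apply le_of_eq; congr 1; ring
      · rw [Set.mem_ofPred_eq, dotp_pt]
        refine (cos_lt_cos_of_abs_lt ?_ (abs_lt.2 ⟨?_, ?_⟩)).le <;>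
          linarith [ha.1, ha.2, hb.1, hb.2]
      · rw [Set.mem_ofPred_eq, dotp_pt]
        apply le_of_eq; congr 1; ring
    have hdisj : AEDisjoint volume (convexHull ℝ (pt '' (Φ : Set ℝ)))
        (convexHull ℝ {pt a, pt (B + Real.pi), pt b}) :=
      measure_mono_null (fun z hz => le_antisymm (hQ hz.1) (hT hz.2))
        (volume_line u (dotp_pt_self _) _)
    rw [← measure_union₀ (Set.Finite.isCompact_convexHull ℝ
      (Set.toFinite _)).measurableSet.nullMeasurableSet hdisj]
    refine measure_mono (Set.union_subset (convexHull_mono (Set.subset_insert _ _))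
      (convexHull_mono ?_))
    rintro _ (rfl | rfl | rfl)
    · exact Or.inr ⟨a, haΦ, rfl⟩
    · exact Or.inl rfl
    · exact Or.inr ⟨b, hbΦ, rfl⟩
  refine (hupper.trans_lt ?_).trans_le hlower
  refine ENNReal.add_lt_add_left (volume_convexHull_lt_top hfin).ne ?_
  rw [volume_convexHull_triple (pt A), volume_convexHull_triple (pt a)]
  refine ENNReal.mul_lt_mul_left volume_standard_triangle_pos.ne'
    (volume_convexHull_lt_top (Set.toFinite _)).ne ?_
  have hlt := abs_cross3_pt_lt hAB hBC ha hb
  exact (ENNReal.ofReal_lt_ofReal_iff_of_nonneg (abs_nonneg _)).2 hlt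

theorem pt_add_pi (x : ℝ) : pt (x + Real.pi) = -pt x := by
  simp [pt]

/-- The angle of the `k`-th point of the antipodal set, counted with its winding number. -/
noncomputable def liftAngle {n : ℕ} (hn : 0 < n) (θ : Fin n → ℝ) (k : ℕ) : ℝ :=
  θ ⟨k % n, Nat.mod_lt k hn⟩ + (k / n : ℕ) * Real.pi

theorem liftAngle_add {n : ℕ} (hn : 0 < n) (θ : Fin n → ℝ) (k : ℕ) :
    liftAngle hn θ (k + n) = liftAngle hn θ k + Real.pi := by
  simp only [liftAngle, Nat.add_mod_right, Nat.add_div_right k hn]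
  push_cast
  ring

theorem strictMono_liftAngle {n : ℕ} (hn : 0 < n) {θ : Fin n → ℝ} (hmono : StrictMono θ)
    (hrange : ∀ i, θ i ∈ Set.Ico 0 Real.pi) : StrictMono (liftAngle hn θ) := by
  refine strictMono_nat_of_lt_succ fun k => ?_
  simp only [liftAngle]
  have hlt := Nat.mod_lt k hn
  have hk := Nat.div_add_mod' k n
  by_cases h : k % n + 1 < n
  · have hd : (k + 1) / n = k / n := by
      rw [Nat.div_eq_iff hn]
      omega
    have hm : (k + 1) % n = k % n + 1 := by
      have := Nat.div_add_mod' (k + 1) n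
      rw [hd] at this
      omega
    rw [hd]
    gcongr
    apply hmono
    rw [Fin.mk_lt_mk, hm]
    exact Nat.lt_succ_self _
  · have hd : (k + 1) / n = k / n + 1 := by
      rw [Nat.div_eq_iff hn, add_one_mul]
      omega
    have h1 := (hrange ⟨k % n, hlt⟩).2
    have h2 := (hrange ⟨(k + 1) % n, Nat.mod_lt _ hn⟩).1
    rw [hd]
    push_cast
    linarith

theorem chosen_add {n : ℕ} (hn : 0 < n) (ε : Fin n → Bool) (k : ℕ) :
    chosen ε (k + n) = !chosen ε k := by
  have hlt := Nat.mod_lt k (by omega : 0 < 2 * n)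
  unfold chosen
  by_cases h : k % (2 * n) < n
  · have hm : (k + n) % (2 * n) = k % (2 * n) + n := by
      rw [Nat.add_mod, Nat.mod_eq_of_lt (by omega : n < 2 * n), Nat.mod_eq_of_lt (by omega)]
    simp [hm, h]
  · have hm : (k + n) % (2 * n) = k % (2 * n) - n := by
      rw [Nat.add_mod, Nat.mod_eq_of_lt (by omega : n < 2 * n), Nat.mod_eq_sub_mod (by omega),
        Nat.mod_eq_of_lt (by omega)]
      omega
    have h' : k % (2 * n) - n < n := by omega
    simp [hm, h, h']

theorem vtx_mod {n : ℕ} (hn : 0 < n) (θ : Fin n → ℝ) (ε : Fin n → Bool) (k : ℕ) :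
    vtx θ ε ⟨k % n, Nat.mod_lt k hn⟩ =
      pt (liftAngle hn θ k + if chosen ε k then 0 else Real.pi) := by
  induction k using Nat.strong_induction_on with
  | _ k ih =>
    rcases lt_or_ge k n with hk | hk
    · have h1 : k % n = k := Nat.mod_eq_of_lt hk
      have h2 : k % (2 * n) = k := Nat.mod_eq_of_lt (by omega)
      have h3 : k / n = 0 := Nat.div_eq_of_lt hk
      by_cases hε : ε ⟨k, hk⟩ <;> simp [vtx, chosen, liftAngle, h1, h2, h3, hk, hε, pt_add_pi]
    · obtain ⟨k, rfl⟩ := Nat.exists_eq_add_of_le' hk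
      have := ih k (by omega)
      simp only [Nat.add_mod_right, this, liftAngle_add, chosen_add hn]
      by_cases hc : chosen ε k <;> simp [hc, pt_add_pi]

theorem range_eq_image_Ico_mod {n : ℕ} (hn : 0 < n) {α : Type*} (f : Fin n → α) (j : ℕ) :
    Set.range f = (fun k : ℕ => f ⟨k % n, Nat.mod_lt k hn⟩) '' Set.Ico j (j + n) := by
  ext x
  constructor
  · rintro ⟨i, rfl⟩
    have hi : (i : ℕ) ∈ (Finset.Ico j (j + n)).image (· % n) := by
      rw [Nat.image_Ico_mod]
      exact Finset.mem_range.2 i.2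
    obtain ⟨k, hk, hki⟩ := Finset.mem_image.1 hi
    refine ⟨k, by simpa using hk, ?_⟩
    exact congrArg f (Fin.ext hki)
  · rintro ⟨k, -, rfl⟩
    exact ⟨_, rfl⟩

/-- If an antipodal polygon contains three consecutive points of S as
vertices, flipping the middle one strictly increases the area. -/
theorem stmt_7 (n : ℕ) (hn : 3 ≤ n) (θ : Fin n → ℝ) (hmono : StrictMono θ)
    (hrange : ∀ i, θ i ∈ Set.Ico 0 Real.pi)
    (ε ε' : Fin n → Bool) (j : ℕ)
    (h1 : chosen ε j = true) (h2 : chosen ε (j + 1) = true)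
    (h3 : chosen ε (j + 2) = true)
    (hε' : ∀ i : Fin n, ε' i = if i.val = (j + 1) % n then !(ε i) else ε i) :
    volume (apoly θ ε) < volume (apoly θ ε') := by
  have hn0 : 0 < n := by omega
  have hΘ := strictMono_liftAngle hn0 hmono hrange
  set Θ := liftAngle hn0 θ with hΘdef
  set ψ : ℕ → ℝ := fun k => Θ k + if chosen ε k then 0 else Real.pi with hψ
  set Φ : Finset ℝ := (Finset.Ico (j + 2) (j + 1 + n)).image ψ with hΦ
  have hIco : Set.Ico (j + 1) (j + 1 + n) = insert (j + 1) (Set.Ico (j + 2) (j + 1 + n)) := by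
    ext k
    simp only [Set.mem_Ico, Set.mem_insert_iff]
    omega
  have hΦcoe : pt '' Φ = (fun k => pt (ψ k)) '' Set.Ico (j + 2) (j + 1 + n) := by
    rw [hΦ, Finset.coe_image, Finset.coe_Ico, Set.image_image]
  have hP : Set.range (vtx θ ε) = insert (pt (Θ (j + 1))) (pt '' Φ) := by
    rw [range_eq_image_Ico_mod hn0 _ (j + 1), hIco, Set.image_insert_eq, hΦcoe]
    simp only [vtx_mod hn0 θ ε, h2, if_true, add_zero, hψ, hΘdef]
  have hP' : Set.range (vtx θ ε') = insert (pt (Θ (j + 1) + Real.pi)) (pt '' Φ) := by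
    rw [range_eq_image_Ico_mod hn0 _ (j + 1), hIco, Set.image_insert_eq, hΦcoe]
    congr 1
    · have hv := vtx_mod hn0 θ ε (j + 1)
      rw [h2, if_pos rfl, add_zero] at hv
      rw [pt_add_pi, hΘdef, ← hv, vtx, vtx, hε', if_pos rfl]
      cases ε ⟨(j + 1) % n, Nat.mod_lt _ hn0⟩ <;> simp
    · refine Set.image_congr fun k hk => ?_
      have hne : k % n ≠ (j + 1) % n := fun h => by
        have := Nat.mod_injOn_Ico (j + 1) n (by simp; have := hk.1; have := hk.2; omega)
          (by simp; omega) h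
        have := hk.1
        omega
      rw [← vtx_mod hn0 θ ε k, vtx, vtx, hε', if_neg hne]
  rw [apoly, apoly, hP, hP']
  have hjn : Θ (j + n) = Θ j + Real.pi := liftAngle_add hn0 θ j
  have hj2n : Θ (j + 2 + n) = Θ (j + 2) + Real.pi := liftAngle_add hn0 θ (j + 2)
  have hlast : ψ (j + n) = Θ j + 2 * Real.pi := by
    simp only [hψ, hjn, chosen_add hn0, h1]
    simp
    ring
  refine volume_convexHull_insert_antipode (A := Θ j) (C := Θ (j + 2)) (hΘ (by omega))
    (hΘ (by omega)) ?_ ?_ ?_ ?_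
  · rw [← hjn]
    exact hΘ (by omega)
  · exact Finset.mem_image.2 ⟨j + 2, by simp; omega, by simp [hψ, h3]⟩
  · exact Finset.mem_image.2 ⟨j + n, by simp; omega, hlast⟩
  · intro φ hφ
    obtain ⟨k, hk, rfl⟩ := Finset.mem_image.1 hφ
    rw [Finset.mem_Ico] at hk
    have hC : Θ (j + 2) ≤ Θ k := hΘ.monotone hk.1
    have hA : Θ k ≤ Θ j + Real.pi := hjn ▸ hΘ.monotone (by omega)
    by_cases hc : chosen ε k
    · left
      have hkn : k < j + n := lt_of_le_of_ne (by omega) fun h => by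
        rw [h, chosen_add hn0, h1] at hc
        exact absurd hc (by simp)
      have := hΘ hkn
      simp only [hψ, hc, if_true, add_zero]
      exact ⟨hC, hjn ▸ this⟩
    · right
      have hk2 : j + 2 < k := lt_of_le_of_ne hk.1 fun h => hc (h ▸ h3)
      have := hΘ hk2
      simp only [hψ, hc, if_false, Bool.false_eq_true]
      constructor <;> linarith
end
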